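/- Let μ be a probability measure on a measurable space Ω, let I ⊆ ℝ be a closed interval, and let Φ : I → ℝ be a C² convex function satisfying (H1). Then the Φ-entropy functional is convex: for all measurable functions f, g : Ω → I such that f, g, Φ∘f, Φ∘g are μ-integrable and for every t ∈ [0,1], one has Ent_μ^Φ(t·f + (1−t)·g) ≤ t·Ent_μ^Φ(f) + (1−t)·Ent_μ^Φ(g). -/

import Mathlib

open MeasureTheory

/-- A continuous function that is convex on the interior of a convex set is convex on the set. -/
lemma ConvexOn.of_interior {E : Type*} [NormedAddCommGroup E] [NormedSpace ℝ E] {S : Set E}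
    {F : E → ℝ} (hS : Convex ℝ S) (hne : (interior S).Nonempty) (hF : ContinuousOn F S)
    (hconv : ConvexOn ℝ (interior S) F) : ConvexOn ℝ S F := by
  obtain ⟨c, hc⟩ := hne
  refine ⟨hS, fun x hx y hy a b ha hb hab => ?_⟩
  let P : E → ℝ → E := fun z e => (1 - e) • z + e • c
  have hP0 (z : E) : P z 0 = z := by simp [P]
  have hPint {z : E} (hz : z ∈ S) {e : ℝ} (he : e ∈ Set.Ioc (0 : ℝ) 1) : P z e ∈ interior S := by
    have := hS.combo_interior_self_mem_interior hc hz he.1 (sub_nonneg.2 he.2)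
      (add_sub_cancel e 1)
    rwa [add_comm] at this
  have hPmem {z : E} (hz : z ∈ S) : Set.MapsTo (P z) (Set.Icc 0 1) S := fun e he =>
    hS hz (interior_subset hc) (sub_nonneg.2 he.2) he.1 (sub_add_cancel 1 e)
  have hcont {z : E} (hz : z ∈ S) : ContinuousOn (fun e => F (P z e)) (Set.Icc 0 1) :=
    hF.comp (by fun_prop) (hPmem hz)
  have hcl : closure (Set.Ioc (0 : ℝ) 1) = Set.Icc 0 1 := closure_Ioc zero_ne_one
  have key := le_on_closure (s := Set.Ioc (0 : ℝ) 1)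
    (f := fun e => F (P (a • x + b • y) e)) (g := fun e => a • F (P x e) + b • F (P y e))
    (fun e he => by
      have hPc : P (a • x + b • y) e = a • P x e + b • P y e := by
        obtain rfl := eq_sub_of_add_eq hab
        simp only [P]
        module
      rw [hPc]
      exact hconv.2 (hPint hx he) (hPint hy he) ha hb hab)
    (hcl ▸ hcont (hS hx hy ha hb hab))
    (hcl ▸ ((hcont hx).const_smul a).add ((hcont hy).const_smul b))
    (hcl ▸ Set.left_mem_Icc.2 zero_le_one)
  simpa only [hP0] using key

/-- The Bregman divergence of `Φ`, with `φ` in the role of the derivative of `Φ`. -/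
def bregmanDiv (Φ φ : ℝ → ℝ) (p : ℝ × ℝ) : ℝ := Φ p.1 - Φ p.2 - φ p.2 * (p.1 - p.2)

/-- If `(u, v) ↦ Φ''(u) v²` is convex, then the Bregman divergence of `Φ` is jointly convex. -/
lemma convexOn_bregmanDiv {J : Set ℝ} (hJ : Convex ℝ J) {Φ φ ψ : ℝ → ℝ}
    (hΦ : ∀ x ∈ J, HasDerivAt Φ (φ x) x) (hφ : ∀ x ∈ J, HasDerivAt φ (ψ x) x)
    (hψ : ConvexOn ℝ (J ×ˢ (Set.univ : Set ℝ)) (fun p : ℝ × ℝ => ψ p.1 * p.2 ^ 2)) :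
    ConvexOn ℝ (J ×ˢ J) (bregmanDiv Φ φ) := by
  refine ⟨hJ.prod hJ, ?_⟩
  rintro ⟨x, y⟩ ⟨hx, hy⟩ ⟨x', y'⟩ ⟨hx', hy'⟩ a b ha hb hab
  simp only [Prod.smul_mk, Prod.mk_add_mk, smul_eq_mul] at *
  let L : ℝ → ℝ → ℝ → ℝ := fun u v s => v + s * (u - v)
  have hL {u v : ℝ} (hu : u ∈ J) (hv : v ∈ J) {s : ℝ} (hs : s ∈ Set.Icc (0 : ℝ) 1) :
      L u v s ∈ J := by
    have := hJ hv hu (sub_nonneg.2 hs.2) hs.1 (sub_add_cancel 1 s)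
    convert this using 1
    simp only [L, smul_eq_mul]
    ring
  have hLd (u v s : ℝ) : HasDerivAt (L u v) (u - v) s := by
    have h := ((hasDerivAt_id s).mul_const (u - v)).const_add v
    rwa [one_mul] at h
  have hxm : a * x + b * x' ∈ J := hJ hx hx' ha hb hab
  have hym : a * y + b * y' ∈ J := hJ hy hy' ha hb hab
  let B : ℝ → ℝ → ℝ → ℝ := fun u v s => bregmanDiv Φ φ (L u v s, v)
  let B' : ℝ → ℝ → ℝ → ℝ := fun u v s => (φ (L u v s) - φ v) * (u - v)
  have hB {u v : ℝ} (hu : u ∈ J) (hv : v ∈ J) {s : ℝ} (hs : s ∈ Set.Icc (0 : ℝ) 1) :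
      HasDerivAt (B u v) (B' u v s) s := by
    have h1 := (hΦ _ (hL hu hv hs)).comp s (hLd u v s)
    have h2 := (h1.sub_const (Φ v)).sub (((hLd u v s).sub_const v).const_mul (φ v))
    exact h2.congr_deriv (sub_mul _ _ _).symm
  have hB' {u v : ℝ} (hu : u ∈ J) (hv : v ∈ J) {s : ℝ} (hs : s ∈ Set.Icc (0 : ℝ) 1) :
      HasDerivAt (B' u v) (ψ (L u v s) * (u - v) ^ 2) s := by
    have h1 := (hφ _ (hL hu hv hs)).comp s (hLd u v s)
    have h2 := (h1.sub_const (φ v)).mul_const (u - v)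
    exact h2.congr_deriv (by ring)
  let G : ℝ → ℝ := fun s => a * B x y s + b * B x' y' s - B (a * x + b * x') (a * y + b * y') s
  let G' : ℝ → ℝ := fun s =>
    a * B' x y s + b * B' x' y' s - B' (a * x + b * x') (a * y + b * y') s
  have hG {s : ℝ} (hs : s ∈ Set.Icc (0 : ℝ) 1) : HasDerivAt G (G' s) s :=
    (((hB hx hy hs).const_mul a).add ((hB hx' hy' hs).const_mul b)).sub (hB hxm hym hs)
  have hG' {s : ℝ} (hs : s ∈ Set.Icc (0 : ℝ) 1) :=
    (((hB' hx hy hs).const_mul a).add ((hB' hx' hy' hs).const_mul b)).sub (hB' hxm hym hs)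
  have hGm' : MonotoneOn G' (Set.Icc 0 1) := by
    refine monotoneOn_of_hasDerivWithinAt_nonneg (convex_Icc 0 1)
      (fun s hs => (hG' hs).continuousAt.continuousWithinAt)
      (fun s hs => (hG' (interior_subset hs)).hasDerivWithinAt) (fun s hs => ?_)
    have hs := interior_subset hs
    have h := hψ.2 (x := (L x y s, x - y)) (y := (L x' y' s, x' - y'))
      ⟨hL hx hy hs, trivial⟩ ⟨hL hx' hy' hs, trivial⟩ ha hb hab
    simp only [Prod.smul_mk, Prod.mk_add_mk, smul_eq_mul] at h
    have e1 : a * L x y s + b * L x' y' s = L (a * x + b * x') (a * y + b * y') s := by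
      simp only [L]
      ring
    have e2 : a * (x - y) + b * (x' - y') = a * x + b * x' - (a * y + b * y') := by ring
    rw [e1, e2] at h
    exact sub_nonneg.2 h
  have h0 : (0 : ℝ) ∈ Set.Icc (0 : ℝ) 1 := Set.left_mem_Icc.2 zero_le_one
  have hGm : MonotoneOn G (Set.Icc 0 1) := by
    refine monotoneOn_of_hasDerivWithinAt_nonneg (convex_Icc 0 1)
      (fun s hs => (hG hs).continuousAt.continuousWithinAt)
      (fun s hs => (hG (interior_subset hs)).hasDerivWithinAt) (fun s hs => ?_)
    have hs := interior_subset hs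
    have h := hGm' h0 hs hs.1
    have h00 : G' 0 = 0 := by simp [G', B', L]
    rwa [h00] at h
  have h := hGm h0 (Set.right_mem_Icc.2 zero_le_one) zero_le_one
  have h00 : G 0 = 0 := by simp [G, B, L, bregmanDiv]
  have h01 (u v : ℝ) : B u v 1 = bregmanDiv Φ φ (u, v) := by simp [B, L]
  rw [h00] at h
  simp only [G, h01] at h
  exact sub_nonneg.1 h

/-- The Bregman divergence of a convex function is nonnegative. -/
lemma ConvexOn.bregmanDiv_nonneg {I : Set ℝ} {Φ φ : ℝ → ℝ} (hΦ : ConvexOn ℝ I Φ)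
    (hφ : ∀ x ∈ I, HasDerivWithinAt Φ (φ x) I x) {x y : ℝ} (hx : x ∈ I) (hy : y ∈ I) :
    0 ≤ bregmanDiv Φ φ (x, y) := by
  simp only [bregmanDiv]
  rcases lt_trichotomy x y with h | rfl | h
  · have := hΦ.slope_le_of_hasDerivWithinAt hx hy h (hφ y hy)
    rw [slope_def_field, div_le_iff₀ (sub_pos.2 h)] at this
    linarith
  · simp
  · have := hΦ.le_slope_of_hasDerivWithinAt hy hx h (hφ y hy)
    rw [slope_def_field, le_div_iff₀ (sub_pos.2 h)] at this
    linarith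

/-- A `C²` function on a convex set `I` whose second derivative `Φ''` makes `(u, v) ↦ Φ''(u) v²`
convex has a jointly convex Bregman divergence, up to the boundary of `I`. -/
lemma ContDiffOn.convexOn_bregmanDiv {I : Set ℝ} (hI : Convex ℝ I) (hne : (interior I).Nonempty)
    {Φ : ℝ → ℝ} (hΦ : ContDiffOn ℝ 2 Φ I)
    (hconv : ConvexOn ℝ (I ×ˢ (Set.univ : Set ℝ))
      (fun p : ℝ × ℝ => deriv (deriv Φ) p.1 * p.2 ^ 2)) :
    ConvexOn ℝ (I ×ˢ I) (bregmanDiv Φ (derivWithin Φ I)) := by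
  have hu : UniqueDiffOn ℝ I := uniqueDiffOn_convex hI hne
  have hφ : ContDiffOn ℝ 1 (derivWithin Φ I) I := hΦ.derivWithin hu (by norm_num)
  have hfst : Set.MapsTo Prod.fst (I ×ˢ I) I := fun _ hp => hp.1
  have hsnd : Set.MapsTo Prod.snd (I ×ˢ I) I := fun _ hp => hp.2
  refine ConvexOn.of_interior (hI.prod hI) (interior_prod_eq I I ▸ hne.prod hne) ?_ ?_
  · exact ((hΦ.continuousOn.comp continuousOn_fst hfst).sub
      (hΦ.continuousOn.comp continuousOn_snd hsnd)).sub
      ((hφ.continuousOn.comp continuousOn_snd hsnd).mul (continuousOn_fst.sub continuousOn_snd))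
  · rw [interior_prod_eq]
    refine _root_.convexOn_bregmanDiv (ψ := deriv (deriv Φ)) hI.interior (fun x hx => ?_)
      (fun x hx => ?_) (hconv.subset (Set.prod_mono_left interior_subset)
        (hI.interior.prod convex_univ))
    · have hd := (hΦ.differentiableOn two_ne_zero).differentiableAt (mem_interior_iff_mem_nhds.1 hx)
      rw [derivWithin_of_mem_nhds (mem_interior_iff_mem_nhds.1 hx)]
      exact hd.hasDerivAt
    · have hd := (hφ.differentiableOn one_ne_zero).differentiableAt (mem_interior_iff_mem_nhds.1 hx)
      have heq : derivWithin Φ I =ᶠ[nhds x] deriv Φ := by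
        filter_upwards [isOpen_interior.mem_nhds hx] with y hy
        exact derivWithin_of_mem_nhds (mem_interior_iff_mem_nhds.1 hy)
      rw [← heq.deriv_eq]
      exact hd.hasDerivAt

section Entropy

variable {Ω : Type*} [MeasurableSpace Ω] {μ : Measure Ω} {Φ φ : ℝ → ℝ} {f : Ω → ℝ}

lemma integrable_bregmanDiv [IsFiniteMeasure μ] (hf : Integrable f μ)
    (hΦf : Integrable (fun ω => Φ (f ω)) μ) (m : ℝ) :
    Integrable (fun ω => bregmanDiv Φ φ (f ω, m)) μ := by
  have h : Integrable (fun ω => φ m * (f ω - m)) μ := by fun_prop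
  exact (hΦf.sub (integrable_const (Φ m))).sub h

/-- The Φ-entropy is the mean Bregman divergence to the mean. -/
lemma integral_bregmanDiv_integral [IsProbabilityMeasure μ] (hf : Integrable f μ)
    (hΦf : Integrable (fun ω => Φ (f ω)) μ) :
    ∫ ω, bregmanDiv Φ φ (f ω, ∫ ω, f ω ∂μ) ∂μ = (∫ ω, Φ (f ω) ∂μ) - Φ (∫ ω, f ω ∂μ) := by
  simp only [bregmanDiv]
  rw [integral_sub (hΦf.sub' (integrable_const _)) (by fun_prop),
    integral_sub hΦf (integrable_const _),
    integral_const_mul, integral_sub hf (integrable_const _)]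
  simp

end Entropy

/-- **Convexity of the Φ-entropy functional.** If `Φ` is a `C²` convex function on a closed
interval `I` satisfying hypothesis `(H1)` (the bivariate map `(u,v) ↦ Φ''(u)·v²` is nonnegative
and convex on `I × ℝ`), then for a probability measure `μ` the Φ-entropy
`Ent_μ^Φ(f) = ∫ Φ(f) dμ − Φ(∫ f dμ)` is a convex functional of `f`. -/
theorem phiEntropy_convex
    {Ω : Type*} [MeasurableSpace Ω] (μ : Measure Ω) [IsProbabilityMeasure μ]
    (I : Set ℝ) (hI : Convex ℝ I) (hIc : IsClosed I)
    (Φ : ℝ → ℝ) (hΦ : ContDiffOn ℝ 2 Φ I) (hΦconv : ConvexOn ℝ I Φ)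
    (hH1nonneg : ∀ u ∈ I, ∀ v : ℝ, 0 ≤ deriv (deriv Φ) u * v ^ 2)
    (hH1conv : ConvexOn ℝ (I ×ˢ (Set.univ : Set ℝ))
      (fun p : ℝ × ℝ => deriv (deriv Φ) p.1 * p.2 ^ 2))
    (f g : Ω → ℝ) (hfm : Measurable f) (hgm : Measurable g)
    (hfI : ∀ ω, f ω ∈ I) (hgI : ∀ ω, g ω ∈ I)
    (hfint : Integrable f μ) (hgint : Integrable g μ)
    (hΦf : Integrable (fun ω => Φ (f ω)) μ) (hΦg : Integrable (fun ω => Φ (g ω)) μ)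
    (t : ℝ) (ht : t ∈ Set.Icc (0 : ℝ) 1) :
    (∫ ω, Φ (t * f ω + (1 - t) * g ω) ∂μ) - Φ (∫ ω, (t * f ω + (1 - t) * g ω) ∂μ)
      ≤ t * ((∫ ω, Φ (f ω) ∂μ) - Φ (∫ ω, f ω ∂μ))
        + (1 - t) * ((∫ ω, Φ (g ω) ∂μ) - Φ (∫ ω, g ω ∂μ)) := by
  have hst : 0 ≤ 1 - t := sub_nonneg.2 ht.2
  have hts : t + (1 - t) = 1 := add_sub_cancel t 1
  rcases (interior I).eq_empty_or_nonempty with hemp | hne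
  · have hsub : I.Subsingleton := by
      by_contra h
      obtain ⟨x, hx, y, hy, hxy⟩ := (Set.not_subsingleton_iff.1 h).exists_lt
      have hmem : Set.Ioo x y ⊆ interior I := interior_maximal
        (Set.Ioo_subset_Icc_self.trans (hI.ordConnected.out hx hy)) isOpen_Ioo
      exact ((Set.nonempty_Ioo.2 hxy).mono hmem).ne_empty hemp
    obtain rfl : f = g := funext fun ω => hsub (hfI ω) (hgI ω)
    simp only [← add_mul, hts, one_mul, le_refl]
  set h : Ω → ℝ := fun ω => t * f ω + (1 - t) * g ω with hh
  have hhI (ω : Ω) : h ω ∈ I := hI (hfI ω) (hgI ω) ht.1 hst hts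
  have hhm : Measurable h := (hfm.const_mul t).add (hgm.const_mul (1 - t))
  have hhint : Integrable h μ := (hfint.const_mul t).add (hgint.const_mul (1 - t))
  have hmean : ∫ ω, h ω ∂μ = t * ∫ ω, f ω ∂μ + (1 - t) * ∫ ω, g ω ∂μ := by
    rw [hh, integral_add (hfint.const_mul t) (hgint.const_mul (1 - t)), integral_const_mul,
      integral_const_mul]
  have hmf : ∫ ω, f ω ∂μ ∈ I := hI.integral_mem hIc (ae_of_all _ hfI) hfint
  have hmg : ∫ ω, g ω ∂μ ∈ I := hI.integral_mem hIc (ae_of_all _ hgI) hgint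
  have hmh : ∫ ω, h ω ∂μ ∈ I := hI.integral_mem hIc (ae_of_all _ hhI) hhint
  set φ := derivWithin Φ I
  have hφ : ∀ x ∈ I, HasDerivWithinAt Φ (φ x) I x := fun x hx =>
    (hΦ.differentiableOn two_ne_zero x hx).hasDerivWithinAt
  have hΦhm : Measurable fun ω => Φ (h ω) :=
    (continuousOn_iff_continuous_domRestrict.1 hΦ.continuousOn).measurable.comp
      (hhm.subtype_mk (h := hhI))
  have hΦh : Integrable (fun ω => Φ (h ω)) μ := by
    refine integrable_of_le_of_le hΦhm.aestronglyMeasurable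
      (g₁ := fun ω => Φ (∫ ω, h ω ∂μ) + φ (∫ ω, h ω ∂μ) * (h ω - ∫ ω, h ω ∂μ))
      (g₂ := fun ω => t * Φ (f ω) + (1 - t) * Φ (g ω))
      (ae_of_all _ fun ω => ?_)
      (ae_of_all _ fun ω => hΦconv.2 (hfI ω) (hgI ω) ht.1 hst hts)
      ((integrable_const _).add ((hhint.sub (integrable_const _)).const_mul _))
      ((hΦf.const_mul t).add (hΦg.const_mul (1 - t)))
    have := hΦconv.bregmanDiv_nonneg hφ (hhI ω) hmh
    simp only [bregmanDiv] at this
    linarith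
  rw [← integral_bregmanDiv_integral (φ := φ) hhint hΦh,
    ← integral_bregmanDiv_integral (φ := φ) hfint hΦf,
    ← integral_bregmanDiv_integral (φ := φ) hgint hΦg, ← integral_const_mul,
    ← integral_const_mul, ← integral_add ((integrable_bregmanDiv hfint hΦf _).const_mul t)
      ((integrable_bregmanDiv hgint hΦg _).const_mul (1 - t))]
  refine integral_mono (integrable_bregmanDiv hhint hΦh _)
    (((integrable_bregmanDiv hfint hΦf _).const_mul t).add
      ((integrable_bregmanDiv hgint hΦg _).const_mul (1 - t))) fun ω => ?_
  rw [hmean]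
  exact (hΦ.convexOn_bregmanDiv hI hne hH1conv).2 (Set.mk_mem_prod (hfI ω) hmf)
    (Set.mk_mem_prod (hgI ω) hmg) ht.1 hst hts
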